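/- arXiv:1707.01315 — 2 statements merged into one kernel-verified Lean document; each statement's English description precedes it below -/
import Mathlib

section
/- Chebyshev-type consequence of the circle method: There is an absolute constant C such that the following holds. Let H ≥ 1 and η, F, G, X > 0. Let f, g : ℤ → ℂ be finitely supported, let 𝔐 be a measurable subset of ℝ/ℤ and 𝔪 := (ℝ/ℤ) ∖ 𝔐, let (MT_h)_{h∈ℤ} be complex numbers, and let h₀ be an integer. Assume: (i) ∑_{n∈ℤ} |f(n)|² ≤ F²X and ∑_{n∈ℤ} |g(n)|² ≤ G²X; (ii) for all integers h with |h − h₀| ≤ H outside an exceptional set of cardinality at most ηH, one has |∫_{𝔐} S_f(α) conj(S_g(α)) e(αh) dα − MT_h| ≤ η F G X; (iii) for every α ∈ 𝔪, ∫_{𝔪 ∩ [α − 1/(2H), α + 1/(2H)]} |S_f(β)|² dβ ≤ η⁶ F² X. Then for all integers h with |h − h₀| ≤ H outside an exceptional set of cardinality at most C·η·H, one has |∑_{n∈ℤ} f(n)·conj(g(n+h)) − MT_h| ≤ C · η · F G X. -/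
open scoped BigOperators
open Real MeasureTheory

/-- The exponential sum `S_f(α) = ∑_{n ∈ ℤ} f(n) e(αn)` on the circle `ℝ/ℤ`. -/
noncomputable def circleExpSum (f : ℤ → ℂ) (α : AddCircle (1 : ℝ)) : ℂ :=
  ∑ᶠ n : ℤ, f n * fourier n α

open AddCircle ComplexConjugate

lemma circleExpSum_eq_sum {f : ℤ → ℂ} (hf : (Function.support f).Finite)
    (α : AddCircle (1 : ℝ)) : circleExpSum f α = ∑ n ∈ hf.toFinset, f n * fourier n α := by
  refine finsum_eq_sum_of_support_subset _ fun n hn ↦ ?_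
  have : f n ≠ 0 := left_ne_zero_of_mul hn
  simpa using this

lemma continuous_circleExpSum {f : ℤ → ℂ} (hf : (Function.support f).Finite) :
    Continuous (circleExpSum f) := by
  simp_rw [funext (circleExpSum_eq_sum hf)]
  fun_prop

lemma volume_unitAddCircle_eq_haarAddCircle :
    (volume : Measure (AddCircle (1 : ℝ))) = haarAddCircle := by
  simp [volume_eq_smul_haarAddCircle]

lemma integral_fourier (k : ℤ) :
    ∫ α : AddCircle (1 : ℝ), fourier k α = if k = 0 then 1 else 0 := by
  have h := congrFun (fourierCoeff_fourier (T := 1) k) 0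
  simp only [fourierCoeff, neg_zero, fourier_zero, one_smul,
    ← volume_unitAddCircle_eq_haarAddCircle] at h
  rw [h, Pi.single_apply]
  simp [eq_comm]

lemma integral_circleExpSum_mul_conj_mul_fourier {f g : ℤ → ℂ}
    (hf : (Function.support f).Finite) (hg : (Function.support g).Finite) (h : ℤ) :
    ∫ α, circleExpSum f α * conj (circleExpSum g α) * fourier h α =
      ∑ᶠ n : ℤ, f n * conj (g (n + h)) := by
  have h_int (n m : ℤ) : ∫ α : AddCircle (1 : ℝ), f n * conj (g m) * fourier (n - m + h) α =
      if m = n + h then f n * conj (g m) else 0 := by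
    rw [integral_const_mul, integral_fourier]
    simp [show n - m + h = 0 ↔ m = n + h by omega]
  have hexp (α : AddCircle (1 : ℝ)) : circleExpSum f α * conj (circleExpSum g α) * fourier h α =
      ∑ n ∈ hf.toFinset, ∑ m ∈ hg.toFinset, f n * conj (g m) * fourier (n - m + h) α := by
    rw [circleExpSum_eq_sum hf, circleExpSum_eq_sum hg, map_sum, Finset.sum_mul_sum,
      Finset.sum_mul]
    refine Finset.sum_congr rfl fun n _ ↦ ?_
    rw [Finset.sum_mul]
    refine Finset.sum_congr rfl fun m _ ↦ ?_
    rw [fourier_add, sub_eq_add_neg, fourier_add, fourier_neg, map_mul]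
    ring
  have hc (n m : ℤ) : Integrable fun α : AddCircle (1 : ℝ) ↦
      f n * conj (g m) * fourier (n - m + h) α :=
    Continuous.integrable_of_hasCompactSupport (by fun_prop) (.of_compactSpace _)
  simp_rw [hexp]
  rw [integral_finsetSum _ fun n _ ↦ integrable_finsetSum _ fun m _ ↦ hc n m]
  simp_rw [integral_finsetSum hg.toFinset fun m _ ↦ hc _ m, h_int, Finset.sum_ite_eq']
  rw [finsum_eq_sum_of_support_subset (s := hf.toFinset)]
  · refine Finset.sum_congr rfl fun n _ ↦ ?_
    split_ifs with hn
    · rfl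
    · have : g (n + h) = 0 := by simpa using hn
      simp [this]
  · intro n hn
    have : f n ≠ 0 := left_ne_zero_of_mul hn
    simpa using this

lemma integral_norm_circleExpSum_sq {f : ℤ → ℂ} (hf : (Function.support f).Finite) :
    ∫ α, ‖circleExpSum f α‖ ^ 2 = ∑ᶠ n : ℤ, ‖f n‖ ^ 2 := by
  have h := integral_circleExpSum_mul_conj_mul_fourier hf hf 0
  simp only [fourier_zero, mul_one, add_zero, Complex.mul_conj'] at h
  have hsum : ∑ᶠ n : ℤ, (‖f n‖ : ℂ) ^ 2 = ((∑ᶠ n : ℤ, ‖f n‖ ^ 2 : ℝ) : ℂ) := by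
    have := Complex.ofRealHom.toAddMonoidHom.map_finsum (f := fun n : ℤ ↦ ‖f n‖ ^ 2)
      (hf.subset fun n hn ↦ by simpa using hn)
    simpa using this.symm
  rw [hsum] at h
  norm_cast at h

lemma norm_fourier_apply (k : ℤ) (α : AddCircle (1 : ℝ)) : ‖fourier k α‖ = 1 := by
  rw [fourier_apply]
  exact Circle.norm_coe _

lemma sum_norm_fourierCoeff_sq_le {U : AddCircle (1 : ℝ) → ℂ} (hU : MemLp U 2 haarAddCircle)
    (s : Finset ℤ) : ∑ k ∈ s, ‖fourierCoeff U k‖ ^ 2 ≤ ∫ α, ‖U α‖ ^ 2 ∂haarAddCircle := by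
  have h := hasSum_sq_fourierCoeff (hU.toLp U)
  rw [fourierCoeff_congr_ae hU.coeFn_toLp] at h
  have h2 : ∫ α, ‖hU.toLp U α‖ ^ 2 ∂haarAddCircle = ∫ α, ‖U α‖ ^ 2 ∂haarAddCircle :=
    integral_congr_ae <| by
      filter_upwards [hU.coeFn_toLp] with α hα
      rw [hα]
  rw [h2] at h
  exact sum_le_hasSum s (fun _ _ ↦ by positivity) h

lemma sum_norm_integral_mul_fourier_sq_le {U : AddCircle (1 : ℝ) → ℂ} (hU : MemLp U 2)
    (s : Finset ℤ) : ∑ k ∈ s, ‖∫ α, U α * fourier k α‖ ^ 2 ≤ ∫ α, ‖U α‖ ^ 2 := by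
  rw [volume_unitAddCircle_eq_haarAddCircle] at hU ⊢
  have h := sum_norm_fourierCoeff_sq_le hU (s.map (Equiv.neg ℤ).toEmbedding)
  rw [Finset.sum_map] at h
  refine le_of_eq_of_le (Finset.sum_congr rfl fun k _ ↦ ?_) h
  simp only [fourierCoeff, Equiv.coe_toEmbedding, Equiv.neg_apply, neg_neg, smul_eq_mul, mul_comm]

lemma norm_integral_mul_sq_le {Ω : Type*} [MeasurableSpace Ω] {μ : Measure Ω} {p q : Ω → ℂ}
    (hp : MemLp p 2 μ) (hq : MemLp q 2 μ) :
    ‖∫ x, p x * q x ∂μ‖ ^ 2 ≤ (∫ x, ‖p x‖ ^ 2 ∂μ) * ∫ x, ‖q x‖ ^ 2 ∂μ := by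
  have h := integral_mul_norm_le_Lp_mul_Lq Real.HolderConjugate.two_two
    (f := p) (g := q) (μ := μ) (by simpa using hp) (by simpa using hq)
  have h1 : ‖∫ x, p x * q x ∂μ‖ ≤ ∫ x, ‖p x‖ * ‖q x‖ ∂μ := by
    simpa using norm_integral_le_integral_norm (μ := μ) fun x ↦ p x * q x
  have h0 : 0 ≤ ∫ x, ‖p x‖ ^ 2 ∂μ := integral_nonneg fun _ ↦ by positivity
  have h0' : 0 ≤ ∫ x, ‖q x‖ ^ 2 ∂μ := integral_nonneg fun _ ↦ by positivity
  simp only [Real.rpow_ofNat, ← Real.sqrt_eq_rpow, ← Real.sqrt_mul h0] at h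
  calc _ ≤ (√((∫ x, ‖p x‖ ^ 2 ∂μ) * ∫ x, ‖q x‖ ^ 2 ∂μ)) ^ 2 := by
        gcongr; exact h1.trans h
    _ = _ := Real.sq_sqrt (by positivity)

lemma stronglyMeasurable_setIntegral_closedBall {E : Type*} [NormedAddCommGroup E]
    [NormedSpace ℝ E] {v : AddCircle (1 : ℝ) → E}
    (hv : StronglyMeasurable v) (δ : ℝ) :
    StronglyMeasurable fun γ ↦ ∫ α in Metric.closedBall γ δ, v α := by
  have hS : MeasurableSet {p : AddCircle (1 : ℝ) × AddCircle (1 : ℝ) | dist p.2 p.1 ≤ δ} :=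
    measurableSet_le (by fun_prop) (by fun_prop)
  have h := StronglyMeasurable.integral_prod_right (ν := volume) (f := fun γ α ↦
    {p : AddCircle (1 : ℝ) × AddCircle (1 : ℝ) | dist p.2 p.1 ≤ δ}.indicator (fun p ↦ v p.2) (γ, α))
    ((hv.comp_measurable measurable_snd).indicator hS)
  convert h using 2 with γ
  rw [← integral_indicator measurableSet_closedBall]
  rfl

lemma integral_setIntegral_closedBall_mul_fourier {v : AddCircle (1 : ℝ) → ℂ}
    (hv : Integrable v) (δ : ℝ) (k : ℤ) :
    ∫ γ, (∫ α in Metric.closedBall γ δ, v α) * fourier k γ =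
      (∫ α, v α * fourier k α) * ∫ t in Metric.closedBall (0 : AddCircle (1 : ℝ)) δ, fourier k t := by
  have hS : MeasurableSet {p : AddCircle (1 : ℝ) × AddCircle (1 : ℝ) | dist p.2 p.1 ≤ δ} :=
    measurableSet_le (by fun_prop) (by fun_prop)
  set K : AddCircle (1 : ℝ) × AddCircle (1 : ℝ) → ℂ :=
    {p : AddCircle (1 : ℝ) × AddCircle (1 : ℝ) | dist p.2 p.1 ≤ δ}.indicator
      fun p ↦ v p.2 * fourier k p.1 with hK
  have hKint : Integrable K (volume.prod volume) := by
    refine Integrable.indicator ?_ hS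
    exact (hv.comp_snd volume).mul_bdd (c := 1) (by fun_prop)
      (.of_forall fun p ↦ (norm_fourier_apply k p.1).le)
  calc ∫ γ, (∫ α in Metric.closedBall γ δ, v α) * fourier k γ
      = ∫ γ, ∫ α, K (γ, α) := by
        refine integral_congr_ae (.of_forall fun γ ↦ ?_)
        dsimp only
        rw [← integral_mul_const, ← integral_indicator measurableSet_closedBall]
        rfl
    _ = ∫ α, ∫ γ, K (γ, α) := integral_integral_swap hKint
    _ = ∫ α, v α * fourier k α * ∫ t in Metric.closedBall (0 : AddCircle (1 : ℝ)) δ, fourier k t := by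
        refine integral_congr_ae (.of_forall fun α ↦ ?_)
        dsimp only
        rw [← integral_add_right_eq_self _ α, ← integral_const_mul,
          ← integral_indicator measurableSet_closedBall]
        refine integral_congr_ae (.of_forall fun t ↦ ?_)
        simp only [hK, Set.indicator, Set.mem_ofPred_eq, Metric.mem_closedBall, dist_zero_right]
        have : dist α (t + α) = ‖t‖ := by simp [dist_eq_norm]
        rw [this]
        congr 1
        rw [fourier_apply, fourier_apply, fourier_apply, smul_add, toCircle_add]
        push_cast
        ring
    _ = _ := integral_mul_const _ _

lemma norm_fourier_sub_one_le (k : ℤ) (t : AddCircle (1 : ℝ)) :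
    ‖fourier k t - 1‖ ≤ 2 * π * |(k : ℝ)| * ‖t‖ := by
  obtain ⟨x, rfl⟩ := QuotientAddGroup.mk_surjective t
  have hx : (QuotientAddGroup.mk x : AddCircle (1 : ℝ)) = ((x - round x : ℝ) : AddCircle (1 : ℝ)) := by
    have : ((round x : ℝ) : AddCircle (1 : ℝ)) = 0 := by
      simp
    rw [AddCircle.coe_sub, this, sub_zero]
  have hn : ‖(QuotientAddGroup.mk x : AddCircle (1 : ℝ))‖ = |x - round x| := UnitAddCircle.norm_eq
  rw [hn, hx, fourier_coe_apply]
  have := Real.norm_exp_I_mul_ofReal_sub_one_le (x := 2 * π * k * (x - round x))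
  rw [Real.norm_eq_abs, abs_mul, abs_mul, abs_of_pos Real.two_pi_pos] at this
  convert this using 4
  push_cast
  ring

lemma volume_real_closedBall_of_le_half {δ : ℝ} (hδ0 : 0 ≤ δ) (hδ : δ ≤ 1 / 2)
    (γ : AddCircle (1 : ℝ)) : volume.real (Metric.closedBall γ δ) = 2 * δ := by
  rw [Measure.real, AddCircle.volume_closedBall, min_eq_right (by linarith),
    ENNReal.toReal_ofReal (by linarith)]

lemma le_norm_setIntegral_closedBall_fourier {δ H : ℝ} (hδ0 : 0 ≤ δ) (hδ : δ ≤ 1 / 2) {k : ℤ}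
    (hk : |(k : ℝ)| ≤ H) (hδH : δ * H ≤ 1 / 16) :
    δ ≤ ‖∫ t in Metric.closedBall (0 : AddCircle (1 : ℝ)) δ, fourier k t‖ := by
  set B := Metric.closedBall (0 : AddCircle (1 : ℝ)) δ
  have hvol : volume.real B = 2 * δ := volume_real_closedBall_of_le_half hδ0 hδ 0
  have h_int (c : ℂ) : IntegrableOn (fun t : AddCircle (1 : ℝ) ↦ fourier k t - c) B :=
    (Continuous.integrable_of_hasCompactSupport (by fun_prop)
      (.of_compactSpace _)).integrableOn
  have hle : ‖∫ t in B, (fourier k t - 1 : ℂ)‖ ≤ 1 / 2 * volume.real B := by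
    refine norm_setIntegral_le_of_norm_le_const (measure_lt_top _ _) fun t ht ↦ ?_
    have ht' : ‖t‖ ≤ δ := by simpa [B] using ht
    have h1 : |(k : ℝ)| * ‖t‖ ≤ 1 / 16 :=
      le_trans (mul_le_mul hk ht' (norm_nonneg _) ((abs_nonneg _).trans hk)) (by linarith)
    have := norm_fourier_sub_one_le k t
    nlinarith [Real.pi_lt_four, Real.pi_pos]
  have heq : ∫ t in B, (fourier k t - 1 : ℂ) = (∫ t in B, fourier k t) - (2 * δ : ℝ) := by
    have h := h_int 0
    simp only [sub_zero] at h
    rw [integral_sub h (integrable_const _), setIntegral_const, hvol]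
    simp
  rw [heq, hvol, norm_sub_rev] at hle
  have := norm_sub_norm_le ((2 * δ : ℝ) : ℂ) (∫ t in B, fourier k t)
  rw [Complex.norm_real, Real.norm_of_nonneg (by linarith)] at this
  linarith

lemma integral_setIntegral_closedBall {r : AddCircle (1 : ℝ) → ℝ} (hr : Integrable r)
    {δ : ℝ} (hδ0 : 0 ≤ δ) (hδ : δ ≤ 1 / 2) :
    ∫ γ, ∫ α in Metric.closedBall γ δ, r α = 2 * δ * ∫ α, r α := by
  have h := integral_setIntegral_closedBall_mul_fourier (v := fun α ↦ (r α : ℂ)) hr.ofReal δ 0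
  simp only [fourier_zero, mul_one, integral_complex_ofReal, setIntegral_const,
    volume_real_closedBall_of_le_half hδ0 hδ, Complex.real_smul] at h
  rw [← Complex.ofReal_mul] at h
  rw [Complex.ofReal_injective h, mul_comm]

lemma sum_norm_integral_mul_fourier_sq_mul_sq_le {p q : AddCircle (1 : ℝ) → ℂ}
    (hpm : StronglyMeasurable p) (hqm : StronglyMeasurable q) (hp : MemLp p 2) (hq : MemLp q 2)
    {A δ H : ℝ} (hδ0 : 0 ≤ δ) (hδ : δ ≤ 1 / 2) (hδH : δ * H ≤ 1 / 16)
    (hA : ∀ γ, ∫ α in Metric.closedBall γ δ, ‖p α‖ ^ 2 ≤ A)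
    (h₀ : ℤ) (s : Finset ℤ) (hs : ∀ h ∈ s, |(h : ℝ) - h₀| ≤ H) :
    (∑ h ∈ s, ‖∫ α, p α * q α * fourier h α‖ ^ 2) * δ ^ 2 ≤
      A * (2 * δ * ∫ α, ‖q α‖ ^ 2) := by
  set v : AddCircle (1 : ℝ) → ℂ := fun α ↦ p α * (q α * fourier h₀ α) with hv
  have hfm : StronglyMeasurable fun α : AddCircle (1 : ℝ) ↦ fourier h₀ α :=
    (map_continuous (fourier h₀)).stronglyMeasurable
  have hqf : MemLp (fun α ↦ q α * fourier h₀ α) 2 := by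
    refine hq.of_le (hqm.mul hfm).aestronglyMeasurable (.of_forall fun α ↦ ?_)
    rw [norm_mul, norm_fourier_apply, mul_one]
  have hvi : Integrable v := hp.integrable_mul hqf
  have hvm : StronglyMeasurable v := hpm.mul (hqm.mul hfm)
  set U : AddCircle (1 : ℝ) → ℂ := fun γ ↦ ∫ α in Metric.closedBall γ δ, v α with hU
  have hU2 : MemLp U 2 := by
    refine MemLp.of_bound (stronglyMeasurable_setIntegral_closedBall hvm δ).aestronglyMeasurable
      (∫ α, ‖v α‖) (.of_forall fun γ ↦ ?_)
    exact (norm_integral_le_integral_norm _).trans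
      (setIntegral_le_integral hvi.norm (.of_forall fun _ ↦ norm_nonneg _))
  have hUle (γ : AddCircle (1 : ℝ)) :
      ‖U γ‖ ^ 2 ≤ A * ∫ α in Metric.closedBall γ δ, ‖q α‖ ^ 2 := by
    refine (norm_integral_mul_sq_le (hp.restrict _) (hqf.restrict _)).trans ?_
    simp only [norm_mul, norm_fourier_apply, mul_one]
    exact mul_le_mul_of_nonneg_right (hA γ) (integral_nonneg fun _ ↦ by positivity)
  calc (∑ h ∈ s, ‖∫ α, p α * q α * fourier h α‖ ^ 2) * δ ^ 2
      ≤ ∑ h ∈ s, ‖∫ γ, U γ * fourier (h - h₀) γ‖ ^ 2 := by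
        rw [Finset.sum_mul]
        refine Finset.sum_le_sum fun h hh ↦ ?_
        have hc := le_norm_setIntegral_closedBall_fourier hδ0 hδ (k := h - h₀)
          (by exact_mod_cast hs h hh) hδH
        rw [integral_setIntegral_closedBall_mul_fourier hvi, norm_mul, mul_pow]
        have : ∀ α, v α * fourier (h - h₀) α = p α * q α * fourier h α := fun α ↦ by
          rw [← sub_add_cancel h h₀, fourier_add, hv, add_sub_cancel_right]
          ring
        simp_rw [this]
        gcongr
    _ = ∑ k ∈ s.map (Equiv.subRight h₀).toEmbedding, ‖∫ γ, U γ * fourier k γ‖ ^ 2 := by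
        rw [Finset.sum_map]; rfl
    _ ≤ ∫ γ, ‖U γ‖ ^ 2 := sum_norm_integral_mul_fourier_sq_le hU2 _
    _ ≤ ∫ γ, A * ∫ α in Metric.closedBall γ δ, ‖q α‖ ^ 2 := by
        refine integral_mono (hU2.integrable_norm_pow two_ne_zero) ?_ hUle
        have hqi := hq.integrable_norm_pow two_ne_zero
        refine .const_mul (Integrable.of_bound ?_ (∫ α, ‖q α‖ ^ 2) (.of_forall fun γ ↦ ?_)) A
        · exact (stronglyMeasurable_setIntegral_closedBall
            (hqm.norm.pow 2) δ).aestronglyMeasurable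
        · rw [Real.norm_of_nonneg (integral_nonneg fun _ ↦ by positivity)]
          exact setIntegral_le_integral hqi (.of_forall fun _ ↦ by positivity)
    _ = A * (2 * δ * ∫ α, ‖q α‖ ^ 2) := by
        rw [integral_const_mul, integral_setIntegral_closedBall
          (hq.integrable_norm_pow two_ne_zero) hδ0 hδ]

lemma card_mul_sq_le_of_le_norm_setIntegral_circleExpSum {f g : ℤ → ℂ}
    (hf : (Function.support f).Finite) (hg : (Function.support g).Finite)
    {𝔪 : Set (AddCircle (1 : ℝ))} (h𝔪 : MeasurableSet 𝔪) {A B T H : ℝ} (hH : 1 ≤ H) (hA : 0 ≤ A)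
    (hgB : ∑ᶠ n : ℤ, ‖g n‖ ^ 2 ≤ B)
    (hfA : ∀ α ∈ 𝔪, ∫ β in 𝔪 ∩ Metric.closedBall α (1 / (2 * H)), ‖circleExpSum f β‖ ^ 2 ≤ A)
    (hT : 0 ≤ T) (h₀ : ℤ) (s : Finset ℤ) (hs : ∀ h ∈ s, |(h : ℝ) - h₀| ≤ H)
    (hsT : ∀ h ∈ s,
      T ≤ ‖∫ α in 𝔪, circleExpSum f α * conj (circleExpSum g α) * fourier h α‖) :
    s.card * T ^ 2 ≤ 32 * H * A * B := by
  have hfc := continuous_circleExpSum hf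
  have hgc : Continuous fun α ↦ conj (circleExpSum g α) :=
    Complex.continuous_conj.comp (continuous_circleExpSum hg)
  have hH0 : 0 < H := by linarith
  have hLp {u : AddCircle (1 : ℝ) → ℂ} (hu : Continuous u) : MemLp u 2 :=
    hu.memLp_of_hasCompactSupport (.of_compactSpace _)
  have hsmall : 2 * (1 / (16 * H)) ≤ 1 / (2 * H) := by
    rw [show 2 * (1 / (16 * H)) = 1 / (2 * H) / 4 by field_simp; norm_num]
    linarith [show 0 ≤ 1 / (2 * H) by positivity]
  have hloc (γ : AddCircle (1 : ℝ)) :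
      ∫ α in Metric.closedBall γ (1 / (16 * H)), ‖𝔪.indicator (circleExpSum f) α‖ ^ 2 ≤ A := by
    have heq : (fun α ↦ ‖𝔪.indicator (circleExpSum f) α‖ ^ 2) =
        𝔪.indicator fun α ↦ ‖circleExpSum f α‖ ^ 2 := by
      ext α
      by_cases h : α ∈ 𝔪 <;> simp [h]
    rw [heq, setIntegral_indicator h𝔪, Set.inter_comm]
    obtain h | ⟨α, hα, hαγ⟩ := (𝔪 ∩ Metric.closedBall γ (1 / (16 * H))).eq_empty_or_nonempty
    · rw [h]
      simpa using hA
    refine (setIntegral_mono_set ?_ (.of_forall fun _ ↦ by positivity) ?_).trans (hfA α hα)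
    · exact ((hLp hfc).integrable_norm_pow two_ne_zero).integrableOn
    · refine (Set.inter_subset_inter_right _ (Metric.closedBall_subset_closedBall' ?_)).eventuallyLE
      rw [Metric.mem_closedBall'] at hαγ
      linarith
  have h16 : 1 / (16 * H) ≤ 1 / 2 := by
    rw [div_le_div_iff₀ (by positivity) (by norm_num)]
    linarith
  have key := sum_norm_integral_mul_fourier_sq_mul_sq_le
    (hfc.stronglyMeasurable.indicator h𝔪) hgc.stronglyMeasurable
    ((hLp hfc).indicator h𝔪) (hLp hgc) (by positivity) h16
    (H := H) (by field_simp; norm_num) hloc h₀ s hs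
  simp only [RCLike.norm_conj, integral_norm_circleExpSum_sq hg] at key
  have hle : s.card * T ^ 2 ≤ ∑ h ∈ s, ‖∫ α, 𝔪.indicator (circleExpSum f) α *
      conj (circleExpSum g α) * fourier h α‖ ^ 2 := by
    rw [← nsmul_eq_mul]
    refine Finset.card_nsmul_le_sum _ _ _ fun h hh ↦ ?_
    have : ∀ α, 𝔪.indicator (circleExpSum f) α * conj (circleExpSum g α) * fourier h α =
        𝔪.indicator (fun α ↦ circleExpSum f α * conj (circleExpSum g α) * fourier h α) α :=
      fun α ↦ by by_cases hα : α ∈ 𝔪 <;> simp [hα]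
    simp_rw [this, integral_indicator h𝔪]
    gcongr
    exact hsT h hh
  have h1 : (s.card * T ^ 2) * (1 / (16 * H)) ^ 2 ≤ A * (2 * (1 / (16 * H)) * B) :=
    (mul_le_mul_of_nonneg_right hle (by positivity)).trans (key.trans (by gcongr))
  calc s.card * T ^ 2 = (s.card * T ^ 2) * (1 / (16 * H)) ^ 2 * (16 * H) ^ 2 := by field_simp
    _ ≤ A * (2 * (1 / (16 * H)) * B) * (16 * H) ^ 2 := by gcongr
    _ = 32 * H * A * B := by field_simp; ring

lemma card_Icc_ceil_floor_le (h₀ : ℤ) {H : ℝ} (hH : 1 ≤ H) :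
    ((Finset.Icc ⌈(h₀ : ℝ) - H⌉ ⌊(h₀ : ℝ) + H⌋).card : ℝ) ≤ 3 * H := by
  have h0 : (0 : ℤ) ≤ ⌊(h₀ : ℝ) + H⌋ + 1 - ⌈(h₀ : ℝ) - H⌉ := by
    have h1 : h₀ ≤ ⌊(h₀ : ℝ) + H⌋ := Int.le_floor.2 (by linarith)
    have h2 : ⌈(h₀ : ℝ) - H⌉ ≤ h₀ := Int.ceil_le.2 (by linarith)
    omega
  have hc : ((Finset.Icc ⌈(h₀ : ℝ) - H⌉ ⌊(h₀ : ℝ) + H⌋).card : ℝ) =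
      ((⌊(h₀ : ℝ) + H⌋ + 1 - ⌈(h₀ : ℝ) - H⌉ : ℤ) : ℝ) := by
    rw [Int.card_Icc, ← Int.cast_natCast, Int.toNat_of_nonneg h0]
  rw [hc]
  push_cast
  linarith [Int.floor_le ((h₀ : ℝ) + H), Int.le_ceil ((h₀ : ℝ) - H)]

lemma mem_Icc_ceil_floor_iff {h h₀ : ℤ} {H : ℝ} :
    h ∈ Finset.Icc ⌈(h₀ : ℝ) - H⌉ ⌊(h₀ : ℝ) + H⌋ ↔ |(h : ℝ) - h₀| ≤ H := by
  rw [Finset.mem_Icc, Int.ceil_le, Int.le_floor, abs_le]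
  constructor <;> rintro ⟨h1, h2⟩ <;> constructor <;> linarith

/-- **Chebyshev-type consequence of the circle method.** -/
theorem circle_method_chebyshev :
    ∃ C : ℝ, ∀ H η F G X : ℝ, 1 ≤ H → 0 < η → 0 < F → 0 < G → 0 < X →
    ∀ f g : ℤ → ℂ, (Function.support f).Finite → (Function.support g).Finite →
    ∀ 𝔐 : Set (AddCircle (1 : ℝ)), MeasurableSet 𝔐 →
    ∀ MT : ℤ → ℂ, ∀ h₀ : ℤ,
    -- (i) size bounds
    (∑ᶠ n : ℤ, ‖f n‖ ^ 2) ≤ F ^ 2 * X →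
    (∑ᶠ n : ℤ, ‖g n‖ ^ 2) ≤ G ^ 2 * X →
    -- (ii) major arc estimate
    (∃ E₁ : Finset ℤ, (E₁.card : ℝ) ≤ η * H ∧
      ∀ h : ℤ, |(h : ℝ) - (h₀ : ℝ)| ≤ H → h ∉ E₁ →
        ‖(∫ α in 𝔐, circleExpSum f α * (starRingEnd ℂ) (circleExpSum g α) * fourier h α)
            - MT h‖ ≤ η * F * G * X) →
    -- (iii) minor arc estimate
    (∀ α ∈ 𝔐ᶜ,
      (∫ β in 𝔐ᶜ ∩ Metric.closedBall α (1 / (2 * H)), ‖circleExpSum f β‖ ^ 2)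
        ≤ η ^ 6 * F ^ 2 * X) →
    -- conclusion
    ∃ E : Finset ℤ, (E.card : ℝ) ≤ C * η * H ∧
      ∀ h : ℤ, |(h : ℝ) - (h₀ : ℝ)| ≤ H → h ∉ E →
        ‖(∑ᶠ n : ℤ, f n * (starRingEnd ℂ) (g (n + h))) - MT h‖ ≤ C * η * F * G * X := by
  refine ⟨33, fun H η F G X hH hη hF hG hX f g hf hg 𝔐 h𝔐 MT h₀ _ hgX hmajor hminor ↦ ?_⟩
  obtain hη1 | hη1 := lt_or_ge 1 η
  · refine ⟨Finset.Icc ⌈(h₀ : ℝ) - H⌉ ⌊(h₀ : ℝ) + H⌋, ?_,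
      fun h hh hE ↦ absurd (mem_Icc_ceil_floor_iff.2 hh) hE⟩
    nlinarith [card_Icc_ceil_floor_le h₀ hH]
  obtain ⟨E₁, hE₁, hE₁MT⟩ := hmajor
  classical
  set T := η * F * G * X with hT
  have hT0 : 0 < T := by positivity
  set E₂ := {h ∈ Finset.Icc ⌈(h₀ : ℝ) - H⌉ ⌊(h₀ : ℝ) + H⌋ | T ≤
    ‖∫ α in 𝔐ᶜ, circleExpSum f α * conj (circleExpSum g α) * fourier h α‖} with hE₂
  have hcard : (E₂.card : ℝ) ≤ 32 * η * H := by
    have h := card_mul_sq_le_of_le_norm_setIntegral_circleExpSum hf hg h𝔐.compl hH (by positivity) hgX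
      hminor hT0.le h₀ E₂ (fun h hh ↦ mem_Icc_ceil_floor_iff.1 (Finset.mem_filter.1 hh).1)
      (fun h hh ↦ (Finset.mem_filter.1 hh).2)
    refine le_of_mul_le_mul_right (h.trans ?_) (pow_pos hT0 2)
    calc 32 * H * (η ^ 6 * F ^ 2 * X) * (G ^ 2 * X)
        = 32 * (η ^ 3 * η) * H * T ^ 2 := by rw [hT]; ring
      _ ≤ 32 * (1 * η) * H * T ^ 2 := by gcongr; exact pow_le_one₀ hη.le hη1
      _ = 32 * η * H * T ^ 2 := by ring
  refine ⟨E₁ ∪ E₂, ?_, fun h hh hE ↦ ?_⟩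
  · calc ((E₁ ∪ E₂).card : ℝ) ≤ E₁.card + E₂.card := by exact_mod_cast Finset.card_union_le _ _
      _ ≤ 33 * η * H := by linarith
  · rw [Finset.notMem_union] at hE
    have h1 := hE₁MT h hh hE.1
    have h2 : ‖∫ α in 𝔐ᶜ, circleExpSum f α * conj (circleExpSum g α) * fourier h α‖ ≤ T := by
      by_contra! hlt
      exact hE.2 (Finset.mem_filter.2 ⟨mem_Icc_ceil_floor_iff.2 hh, hlt.le⟩)
    have h_int : Integrable fun α ↦ circleExpSum f α * conj (circleExpSum g α) * fourier h α :=
      (((continuous_circleExpSum hf).mul (Complex.continuous_conj.comp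
        (continuous_circleExpSum hg))).mul (map_continuous _)).integrable_of_hasCompactSupport
          (.of_compactSpace _)
    rw [← integral_circleExpSum_mul_conj_mul_fourier hf hg, ← integral_add_compl h𝔐 h_int,
      add_sub_right_comm]
    refine (norm_add_le _ _).trans ((add_le_add h1 h2).trans ?_)
    rw [show 33 * η * F * G * X = 33 * T by rw [hT]; ring]
    linarith
end

section
/- Stationary phase bound for short L² averages of exponential sums (endpoint β = 1/H): There exist absolute constants c ∈ (0,1) and C > 0 such that the following holds. Let 1 ≤ H ≤ X, let f : ℕ → ℂ be supported on the integers in (X, 2X], let η be a real number with 0 < η ≤ c and 1/H ≤ c·η, and set β := 1/H and I := { t ∈ ℝ : η β X ≤ |t| ≤ βX/η }. Then ∫_{β ≤ |θ| ≤ 2β} |S_f(θ)|² dθ ≤ C [ ∫_I |D[f](1/2 + it)|² dt + ((η + 1/(βX))²/H²) ∫_ℝ ( ∑_{x ≤ n ≤ x+H} |f(n)| )² dx ]. -/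
open scoped BigOperators
open Real MeasureTheory

/-- `e(x) = e^{2πix}`. -/
noncomputable def eR (x : ℝ) : ℂ := Complex.exp (2 * Real.pi * Complex.I * x)

/-- The exponential sum `S_f(θ) = ∑_n f(n) e(θn)` of a (finitely supported)
function `f : ℕ → ℂ`. -/
noncomputable def expSumR (f : ℕ → ℂ) (θ : ℝ) : ℂ := ∑ᶠ n : ℕ, f n * eR (θ * n)

/-- The Dirichlet polynomial `D[f](s) = ∑_n f(n) n^{-s}`. -/
noncomputable def dirPoly (f : ℕ → ℂ) (s : ℂ) : ℂ := ∑ᶠ n : ℕ, f n / (n : ℂ) ^ s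

/-- Decay of order four for a Schwartz function and its derivative. -/
lemma SchwartzMap.exists_decay_four (w : SchwartzMap ℝ ℂ) :
    ∃ M : ℝ, 0 < M ∧ ∀ x : ℝ, ‖w x‖ ≤ M / (1 + |x|) ^ 4 ∧ ‖deriv w x‖ ≤ M / (1 + |x|) ^ 4 := by
  set M := 2 ^ 4 * (Finset.Iic ((4, 1) : ℕ × ℕ)).sup
    (fun m => SchwartzMap.seminorm ℝ m.1 m.2) w
  have hM : 0 ≤ M := by positivity
  refine ⟨M + 1, by positivity, fun x => ?_⟩
  have h0 := SchwartzMap.one_add_le_sup_seminorm_apply (𝕜 := ℝ) (m := (4, 1)) (k := 4) (n := 0)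
    le_rfl (by simp) w x
  have h1 := SchwartzMap.one_add_le_sup_seminorm_apply (𝕜 := ℝ) (m := (4, 1)) (k := 4) (n := 1)
    le_rfl (by simp) w x
  rw [norm_iteratedFDeriv_zero, Real.norm_eq_abs] at h0
  rw [norm_iteratedFDeriv_eq_norm_iteratedDeriv, iteratedDeriv_one, Real.norm_eq_abs] at h1
  constructor
  · rw [le_div_iff₀ (by positivity), mul_comm]
    exact h0.trans (by simp [M])
  · rw [le_div_iff₀ (by positivity), mul_comm]
    exact h1.trans (by simp [M])

lemma abs_sub_one_le_four_mul_abs_log {r : ℝ} (h1 : 1 / 4 ≤ r) (h4 : r ≤ 4) :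
    |r - 1| ≤ 4 * |log r| := by
  have hr : 0 < r := by linarith
  rcases le_total 1 r with h | h
  · have hlog := Real.one_sub_inv_le_log_of_pos hr
    have : (r - 1) / 4 ≤ 1 - r⁻¹ := by
      rw [show 1 - r⁻¹ = (r - 1) / r by field_simp]
      exact div_le_div_of_nonneg_left (by linarith) hr h4
    rw [abs_of_nonneg (by linarith), abs_of_nonneg (Real.log_nonneg h)]
    linarith
  · have hlog := Real.log_le_sub_one_of_pos hr
    rw [abs_of_nonpos (by linarith), abs_of_nonpos (by linarith)]
    linarith

lemma abs_log_sub_le {r : ℝ} (h1 : 1 / 4 ≤ r) : |log r - (r - 1)| ≤ 4 * (r - 1) ^ 2 := by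
  have hr : 0 < r := by linarith
  have hlog := Real.one_sub_inv_le_log_of_pos hr
  have hlog' := Real.log_le_sub_one_of_pos hr
  rw [abs_of_nonpos (by linarith)]
  have h : r - 1 - (1 - r⁻¹) = (r - 1) ^ 2 * r⁻¹ := by field_simp
  have hinv : r⁻¹ ≤ 4 := by
    rw [inv_le_comm₀ hr (by norm_num)]; linarith
  nlinarith [mul_le_mul_of_nonneg_left hinv (sq_nonneg (r - 1))]

lemma abs_inv_sqrt_sub_one_le {r : ℝ} (h1 : 1 / 4 ≤ r) : |(√r)⁻¹ - 1| ≤ 4 * |r - 1| := by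
  have hs : 1 / 2 ≤ √r := by
    exact Real.le_sqrt_of_sq_le (by linarith)
  have hs0 : 0 < √r := by linarith
  have hsq : √r ^ 2 = r := Real.sq_sqrt (by linarith)
  have h : (√r)⁻¹ - 1 = (1 - r) * ((√r)⁻¹ * (1 + √r)⁻¹) := by
    field_simp
    linear_combination -hsq
  rw [h, abs_mul, abs_sub_comm 1 r, mul_comm]
  gcongr
  rw [abs_of_pos (by positivity)]
  have e1 : (√r)⁻¹ ≤ 2 := by
    rw [inv_le_comm₀ hs0 (by norm_num)]; linarith
  have e2 : (1 + √r)⁻¹ ≤ 1 := inv_le_one_of_one_le₀ (by linarith)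
  nlinarith [inv_pos.2 hs0, inv_pos.2 (show 0 < 1 + √r by linarith)]

/-- A Schwartz function of `l * log r` agrees with the same function of `l * (r - 1)` up to a
relative error `1 / l`, uniformly for `r` near `1`. -/
lemma SchwartzMap.exists_log_kernel_bound (w : SchwartzMap ℝ ℂ) :
    ∃ K : ℝ, 0 < K ∧ ∀ l : ℝ, 1 ≤ l → ∀ r : ℝ,
      (1 / 4 ≤ r → r ≤ 4 → ‖((√r)⁻¹ : ℂ) * w (l * log r) - w (l * (r - 1))‖
        ≤ K / l * (1 / (1 + (l * (r - 1)) ^ 2))) ∧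
      (1 / 2 ≤ |r - 1| → ‖w (l * (r - 1))‖ ≤ K / l * (1 / (1 + (l * (r - 1)) ^ 2))) := by
  obtain ⟨M, hM, hw⟩ := w.exists_decay_four
  refine ⟨2048 * M, by positivity, fun l hl r => ⟨fun h1 h4 => ?_, fun hr => ?_⟩⟩
  · have hl0 : 0 < l := by linarith
    set d := l * |r - 1| with hd
    have hd0 : 0 ≤ d := by positivity
    have hdr : |r - 1| = d / l := by rw [hd]; field_simp
    have hd2 : (l * (r - 1)) ^ 2 = d ^ 2 := by rw [hd, mul_pow, mul_pow, sq_abs]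
    have decay : ∀ x : ℝ, d / 4 ≤ |x| → M / (1 + |x|) ^ 4 ≤ 256 * M / (1 + d) ^ 4 := by
      intro x hx
      rw [div_le_div_iff₀ (by positivity) (by positivity)]
      have : (1 + d) ^ 4 ≤ (4 * (1 + |x|)) ^ 4 := by gcongr; linarith
      nlinarith
    have hp : d / 4 ≤ |l * log r| := by
      rw [abs_mul, abs_of_pos hl0]
      have := abs_sub_one_le_four_mul_abs_log h1 h4
      have := mul_le_mul_of_nonneg_left this hl0.le
      linarith
    have hq : d / 4 ≤ |l * (r - 1)| := by
      rw [abs_mul, abs_of_pos hl0]; linarith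
    have t1 : ‖(((√r)⁻¹ : ℂ) - 1) * w (l * log r)‖ ≤
        4 * (d / l) * (256 * M / (1 + d) ^ 4) := by
      rw [norm_mul]
      gcongr
      · have : (((√r)⁻¹ : ℂ) - 1) = (((√r)⁻¹ - 1 : ℝ) : ℂ) := by push_cast; rfl
        rw [this, Complex.norm_real, Real.norm_eq_abs, ← hdr]
        exact abs_inv_sqrt_sub_one_le h1
      · exact ((hw _).1).trans (decay _ hp)
    have t2 : ‖w (l * log r) - w (l * (r - 1))‖ ≤
        256 * M / (1 + d) ^ 4 * (4 * d ^ 2 / l) := by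
      have hseg : ∀ x ∈ Set.uIcc (l * (r - 1)) (l * log r), d / 4 ≤ |x| := by
        intro x hx
        rcases le_total 1 r with h | h
        · have a1 : 0 ≤ l * log r := mul_nonneg hl0.le (Real.log_nonneg h)
          have a2 : 0 ≤ l * (r - 1) := mul_nonneg hl0.le (by linarith)
          rw [abs_of_nonneg a1] at hp
          rw [abs_of_nonneg a2] at hq
          exact (le_min hq hp).trans (hx.1.trans (le_abs_self x))
        · have a1 : l * log r ≤ 0 :=
            mul_nonpos_of_nonneg_of_nonpos hl0.le (Real.log_nonpos (by linarith) h)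
          have a2 : l * (r - 1) ≤ 0 := mul_nonpos_of_nonneg_of_nonpos hl0.le (by linarith)
          rw [abs_of_nonpos a1] at hp
          rw [abs_of_nonpos a2] at hq
          have : max (l * (r - 1)) (l * log r) ≤ - (d / 4) := max_le (by linarith) (by linarith)
          have := hx.2.trans this
          have := neg_abs_le x
          linarith
      have mv := (convex_uIcc (l * (r - 1)) (l * log r)).norm_image_sub_le_of_norm_deriv_le
        (f := w) (C := 256 * M / (1 + d) ^ 4) (fun x _ => w.differentiableAt)
        (fun x hx => ((hw x).2).trans (decay x (hseg x hx))) Set.left_mem_uIcc Set.right_mem_uIcc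
      refine mv.trans ?_
      gcongr
      rw [← mul_sub, Real.norm_eq_abs, abs_mul, abs_of_pos hl0]
      have := mul_le_mul_of_nonneg_left (abs_log_sub_le h1) hl0.le
      refine this.trans (le_of_eq ?_)
      rw [← sq_abs (r - 1), hdr]; field_simp
    have split : ((√r)⁻¹ : ℂ) * w (l * log r) - w (l * (r - 1)) =
        (((√r)⁻¹ : ℂ) - 1) * w (l * log r) + (w (l * log r) - w (l * (r - 1))) := by ring
    rw [split, hd2]
    refine (norm_add_le _ _).trans ((add_le_add t1 t2).trans ?_)
    have e : 4 * (d / l) * (256 * M / (1 + d) ^ 4) + 256 * M / (1 + d) ^ 4 * (4 * d ^ 2 / l) =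
      M / l * (1024 * (d + d ^ 2) / (1 + d) ^ 4) := by field_simp; ring
    rw [e, show 2048 * M / l * (1 / (1 + d ^ 2)) = M / l * (2048 / (1 + d ^ 2)) by ring]
    refine mul_le_mul_of_nonneg_left ?_ (by positivity)
    rw [div_le_div_iff₀ (by positivity) (by positivity)]
    nlinarith [pow_nonneg hd0 3, pow_nonneg hd0 4, pow_nonneg hd0 2]
  · have hl0 : 0 < l := by linarith
    have hd : l / 2 ≤ |l * (r - 1)| := by
      rw [abs_mul, abs_of_pos hl0]; nlinarith
    refine ((hw _).1).trans ?_
    rw [← sq_abs (l * (r - 1))]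
    set d := |l * (r - 1)|
    have hd0 : 0 ≤ d := abs_nonneg _
    rw [div_mul_div_comm, div_le_div_iff₀ (by positivity) (by positivity)]
    have : l * (1 + d ^ 2) ≤ 2 * d * (1 + d ^ 2) := by gcongr; linarith
    have : l * (1 + d ^ 2) ≤ 2048 * (1 + d) ^ 4 := by
      nlinarith [pow_nonneg hd0 3, pow_nonneg hd0 4, pow_nonneg hd0 2]
    nlinarith

lemma ENNReal.mul_le_sq_add_sq (x y : ENNReal) : x * y ≤ x ^ 2 + y ^ 2 := by
  rcases le_total x y with h | h
  · exact (mul_le_mul_left h y).trans (by rw [← sq]; exact le_add_self)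
  · exact (mul_le_mul_right h x).trans (by rw [← sq]; exact le_self_add)

lemma ENNReal.add_sq_le (x y : ENNReal) : (x + y) ^ 2 ≤ 3 * x ^ 2 + 3 * y ^ 2 :=
  calc (x + y) ^ 2 = x ^ 2 + y ^ 2 + 2 * (x * y) := by ring
    _ ≤ x ^ 2 + y ^ 2 + 2 * (x ^ 2 + y ^ 2) := by
      gcongr; exact ENNReal.mul_le_sq_add_sq x y
    _ = _ := by ring

lemma ENNReal.tsum_mul_sq_le {ι : Type*} (c a : ι → ENNReal) :
    (∑' j, c j * a j) ^ 2 ≤ 2 * (∑' j, c j) * ∑' j, c j * a j ^ 2 := by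
  calc (∑' j, c j * a j) ^ 2 = ∑' j, ∑' k, (c j * a j) * (c k * a k) := by
        rw [sq, ← ENNReal.tsum_mul_right]
        simp_rw [ENNReal.tsum_mul_left]
    _ ≤ ∑' j, ∑' k, (c j * a j ^ 2 * c k + c j * (c k * a k ^ 2)) := by
        refine ENNReal.tsum_le_tsum fun j => ENNReal.tsum_le_tsum fun k => ?_
        calc (c j * a j) * (c k * a k) = c j * c k * (a j * a k) := by ring
          _ ≤ c j * c k * (a j ^ 2 + a k ^ 2) := by gcongr; exact ENNReal.mul_le_sq_add_sq _ _
          _ = _ := by ring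
    _ = 2 * (∑' j, c j) * ∑' j, c j * a j ^ 2 := by
        simp_rw [ENNReal.tsum_add, ENNReal.tsum_mul_left, ENNReal.tsum_mul_right]
        ring

/-- Mass of `a` in the window `[x, x + H]`. -/
noncomputable def windowSum (s : Finset ℕ) (a : ℕ → ENNReal) (H x : ℝ) : ENNReal :=
  ∑ n ∈ s, (Set.Icc ((n : ℝ) - H) n).indicator (fun _ => a n) x

lemma measurable_windowSum (s : Finset ℕ) (a : ℕ → ENNReal) (H : ℝ) :
    Measurable (windowSum s a H) :=
  Finset.measurable_fun_sum s fun _ _ => measurable_const.indicator measurableSet_Icc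

lemma tsum_ofReal_int_ne_top : ∑' j : ℤ, ENNReal.ofReal (3 / (1 + (j : ℝ) ^ 2)) ≠ ⊤ := by
  have hs : Summable fun j : ℤ => 3 / (1 + (j : ℝ) ^ 2) := by
    have h := ((Real.summable_one_div_int_pow (p := 2)).2 (by norm_num)).mul_left 3
    refine Summable.of_norm_bounded_eventually h ?_
    have : ∀ᶠ j : ℤ in Filter.cofinite, j ≠ 0 := (Set.finite_singleton (0 : ℤ)).compl_mem_cofinite
    filter_upwards [this] with j hj
    have hj' : (0 : ℝ) < (j : ℝ) ^ 2 := by positivity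
    rw [Real.norm_of_nonneg (by positivity), mul_one_div]
    gcongr
    linarith
  exact hs.tsum_ofReal_ne_top

/-- Averages against a kernel with quadratic decay at scale `H` are controlled in `L²` by window
sums of length `H`. -/
lemma exists_lintegral_kernel_sq_le :
    ∃ K : ℝ, 0 < K ∧ ∀ (s : Finset ℕ) (a : ℕ → ENNReal) (H : ℝ), 0 < H →
      ∫⁻ z : ℝ, (∑ n ∈ s, a n * ENNReal.ofReal (1 / (1 + ((z - n) / H) ^ 2))) ^ 2
        ≤ ENNReal.ofReal K * ∫⁻ x : ℝ, windowSum s a H x ^ 2 := by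
  set c : ℤ → ENNReal := fun j => ENNReal.ofReal (3 / (1 + (j : ℝ) ^ 2)) with hc
  set T := ∑' j, c j with hT
  have hTt : T ≠ ⊤ := tsum_ofReal_int_ne_top
  refine ⟨(2 * T * T).toReal + 1, by positivity, fun s a H hH => ?_⟩
  have point : ∀ z : ℝ, ∑ n ∈ s, a n * ENNReal.ofReal (1 / (1 + ((z - n) / H) ^ 2)) ≤
      ∑' j : ℤ, c j * windowSum s a H (z + j * H) := by
    intro z
    have : ∑' j : ℤ, c j * windowSum s a H (z + j * H) = ∑ n ∈ s, ∑' j : ℤ,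
        c j * (Set.Icc ((n : ℝ) - H) n).indicator (fun _ => a n) (z + j * H) := by
      simp_rw [windowSum, Finset.mul_sum]
      exact Summable.tsum_finsetSum fun _ _ => ENNReal.summable
    rw [this]
    refine Finset.sum_le_sum fun n _ => ?_
    refine le_trans ?_ (ENNReal.le_tsum ⌊((n : ℝ) - z) / H⌋)
    set t := ((n : ℝ) - z) / H with ht
    have h1 := Int.floor_le t
    have h2 := Int.lt_floor_add_one t
    have htH : t * H = n - z := by rw [ht]; field_simp
    rw [Set.indicator_of_mem, mul_comm (a n)]
    · gcongr ?_ * a n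
      apply ENNReal.ofReal_le_ofReal
      rw [show ((z - n) / H) ^ 2 = t ^ 2 by rw [ht, ← neg_sub, neg_div, neg_sq],
        div_le_div_iff₀ (by positivity) (by positivity)]
      have : (⌊t⌋ : ℝ) ^ 2 ≤ (|t| + 1) ^ 2 := by
        rw [← sq_abs]
        gcongr
        rw [abs_le]
        constructor <;> linarith [neg_abs_le t, le_abs_self t]
      nlinarith [sq_abs t, sq_nonneg (|t| - 1)]
    · constructor <;> nlinarith
  calc ∫⁻ z : ℝ, (∑ n ∈ s, a n * ENNReal.ofReal (1 / (1 + ((z - n) / H) ^ 2))) ^ 2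
      ≤ ∫⁻ z : ℝ, 2 * T * ∑' j : ℤ, c j * windowSum s a H (z + j * H) ^ 2 := by
        refine lintegral_mono fun z => ?_
        exact (pow_le_pow_left' (point z) 2).trans (ENNReal.tsum_mul_sq_le _ _)
    _ = 2 * T * ∑' j : ℤ, c j * ∫⁻ x : ℝ, windowSum s a H x ^ 2 := by
        have hm : ∀ j : ℤ, Measurable fun z : ℝ => windowSum s a H (z + j * H) ^ 2 := fun j =>
          ((measurable_windowSum s a H).comp (measurable_add_const _)).pow_const 2
        rw [lintegral_const_mul _ (Measurable.tsum fun j => (hm j).const_mul _),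
          lintegral_tsum fun j => ((hm j).const_mul _).aemeasurable]
        congr 2 with j
        rw [lintegral_const_mul _ (hm j),
          lintegral_add_right_eq_self (fun x => windowSum s a H x ^ 2)]
    _ = 2 * T * T * ∫⁻ x : ℝ, windowSum s a H x ^ 2 := by
        rw [ENNReal.tsum_mul_right, ← hT]; ring
    _ ≤ _ := by
        gcongr
        have hne : 2 * T * T ≠ ⊤ := by finiteness
        calc 2 * T * T = ENNReal.ofReal (2 * T * T).toReal := (ENNReal.ofReal_toReal hne).symm
          _ ≤ _ := ENNReal.ofReal_le_ofReal (by linarith)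

lemma continuous_eR : Continuous eR := by
  unfold eR; fun_prop

open FourierTransform ContDiff in
/-- A modulated dilate of a compactly supported smooth function, with its Fourier transform. -/
lemma exists_schwartz_modulation (χ : SchwartzMap ℝ ℂ) (hχ : HasCompactSupport χ) (c m : ℝ)
    (hm : 0 < m) : ∃ A : SchwartzMap ℝ ℂ, (∀ θ, A θ = eR (c * θ) * χ (θ / m)) ∧
      ∀ z, 𝓕 A z = m * 𝓕 χ (m * (z - c)) := by
  have hc : HasCompactSupport fun θ : ℝ => eR (c * θ) * χ (θ / m) := by
    have h := hχ.comp_smul (c := m⁻¹) (by positivity)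
    refine HasCompactSupport.mul_left ?_
    simpa only [smul_eq_mul, div_eq_inv_mul] using h
  have hs : ContDiff ℝ ∞ fun θ : ℝ => eR (c * θ) * χ (θ / m) := by
    have h1 : ContDiff ℝ ∞ fun θ : ℝ => eR (c * θ) := by
      unfold eR
      refine ContDiff.cexp (contDiff_const.mul ?_)
      exact Complex.ofRealCLM.contDiff.comp (contDiff_const.mul contDiff_id)
    exact h1.mul ((χ.smooth ⊤).comp (contDiff_id.div_const m))
  refine ⟨hc.toSchwartzMap hs, fun θ => rfl, fun z => ?_⟩
  rw [SchwartzMap.fourier_coe, SchwartzMap.fourier_coe, Real.fourier_real_eq_integral_exp_smul,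
    Real.fourier_real_eq_integral_exp_smul]
  have h := Measure.integral_comp_div
    (fun v : ℝ => Complex.exp (((-2 * π * v * (m * (z - c)) : ℝ) : ℂ) * Complex.I) • χ v) m
  rw [abs_of_pos hm, Complex.real_smul] at h
  rw [← h]
  congr 1 with θ
  rw [HasCompactSupport.toSchwartzMap_toFun, smul_eq_mul, smul_eq_mul, ← mul_assoc, eR,
    ← Complex.exp_add]
  congr 2
  have : (m : ℂ) ≠ 0 := by exact_mod_cast hm.ne'
  push_cast
  field_simp
  ring

open FourierTransform in
lemma exists_schwartz_sum (χ : SchwartzMap ℝ ℂ) (hχ : HasCompactSupport χ) (s : Finset ℕ)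
    (b : ℕ → ℂ) (c m : ℕ → ℝ) (hm : ∀ n ∈ s, 0 < m n) : ∃ A : SchwartzMap ℝ ℂ,
      (∀ θ, A θ = ∑ n ∈ s, b n * (eR (c n * θ) * χ (θ / m n))) ∧
      ∀ z, 𝓕 A z = ∑ n ∈ s, b n * (m n * 𝓕 χ (m n * (z - c n))) := by
  have : ∀ n, ∃ A : SchwartzMap ℝ ℂ, n ∈ s → (∀ θ, A θ = eR (c n * θ) * χ (θ / m n)) ∧
      ∀ z, 𝓕 A z = m n * 𝓕 χ (m n * (z - c n)) := fun n => by
    by_cases hn : n ∈ s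
    · obtain ⟨A, hA⟩ := exists_schwartz_modulation χ hχ (c n) (m n) (hm n hn)
      exact ⟨A, fun _ => hA⟩
    · exact ⟨0, fun h => absurd h hn⟩
  choose A hA using this
  refine ⟨∑ n ∈ s, b n • A n, fun θ => ?_, fun z => ?_⟩
  · rw [sum_apply]
    exact Finset.sum_congr rfl fun n hn => by rw [smul_apply, (hA n hn).1, smul_eq_mul]
  · rw [fourier_sum, sum_apply]
    exact Finset.sum_congr rfl fun n hn => by
      rw [fourier_smul, smul_apply, (hA n hn).2, smul_eq_mul]

open FourierTransform in
lemma lintegral_enorm_sq_fourier (A : SchwartzMap ℝ ℂ) :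
    ∫⁻ z, ‖𝓕 A z‖ₑ ^ 2 = ∫⁻ θ, ‖A θ‖ₑ ^ 2 := by
  have h : ∀ B : SchwartzMap ℝ ℂ, ∫⁻ z, ‖B z‖ₑ ^ 2 = ENNReal.ofReal (∫ z, ‖B z‖ ^ 2) := fun B => by
    have hint : Integrable fun z => ‖B z‖ ^ 2 := (B.memLp 2).integrable_norm_pow (by norm_num)
    rw [ofReal_integral_eq_lintegral_ofReal hint (ae_of_all _ fun _ => by positivity)]
    congr 1 with z
    rw [ENNReal.ofReal_pow (norm_nonneg _), ofReal_norm]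
  rw [h, h, SchwartzMap.integral_norm_sq_fourier]

open scoped ContDiff in
/-- A smooth cutoff equal to `1` on `1 ≤ |y| ≤ 4` and supported in `1 / 2 < |y| < 9 / 2`. -/
lemma exists_schwartz_cutoff : ∃ χ : SchwartzMap ℝ ℂ, HasCompactSupport χ ∧
    (∀ y, 1 ≤ |y| → |y| ≤ 4 → χ y = 1) ∧ (∀ y, ‖χ y‖ ≤ 2) ∧
    (∀ y, χ y ≠ 0 → 1 / 2 < |y| ∧ |y| < 9 / 2) := by
  let p : ContDiffBump (5 / 2 : ℝ) := ⟨3 / 2, 2, by norm_num, by norm_num⟩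
  let q : ContDiffBump (-5 / 2 : ℝ) := ⟨3 / 2, 2, by norm_num, by norm_num⟩
  have hq : ∀ y, -(1 / 2) ≤ y → q y = 0 := fun y hy => q.zero_of_le_dist (by
    rw [Real.dist_eq, le_abs]; left; change (2 : ℝ) ≤ _; linarith)
  have hp : ∀ y, y ≤ 1 / 2 → p y = 0 := fun y hy => p.zero_of_le_dist (by
    rw [Real.dist_eq, le_abs]; right; change (2 : ℝ) ≤ _; linarith)
  have hcs : HasCompactSupport fun y : ℝ => ((p y + q y : ℝ) : ℂ) :=
    (p.hasCompactSupport.add q.hasCompactSupport).comp_left Complex.ofReal_zero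
  have hsm : ContDiff ℝ ∞ fun y : ℝ => ((p y + q y : ℝ) : ℂ) :=
    Complex.ofRealCLM.contDiff.comp (p.contDiff.add q.contDiff)
  refine ⟨hcs.toSchwartzMap hsm, hcs, fun y h1 h4 => ?_, fun y => ?_, fun y hy => ?_⟩
  · rw [HasCompactSupport.toSchwartzMap_toFun]
    rcases le_abs.1 h1 with h | h
    · rw [hq y (by linarith), p.one_of_mem_closedBall]
      · simp
      · rw [abs_of_pos (by linarith)] at h4
        rw [Metric.mem_closedBall, Real.dist_eq, abs_le]
        change -(3 / 2 : ℝ) ≤ _ ∧ _ ≤ (3 / 2 : ℝ)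
        constructor <;> linarith
    · rw [hp y (by linarith), q.one_of_mem_closedBall]
      · simp
      · rw [abs_of_neg (by linarith)] at h4
        rw [Metric.mem_closedBall, Real.dist_eq, abs_le]
        change -(3 / 2 : ℝ) ≤ _ ∧ _ ≤ (3 / 2 : ℝ)
        constructor <;> linarith
  · rw [HasCompactSupport.toSchwartzMap_toFun, Complex.norm_real, Real.norm_eq_abs,
      abs_of_nonneg (add_nonneg p.nonneg q.nonneg)]
    linarith [p.le_one (x := y), q.le_one (x := y)]
  · by_contra hcon
    apply hy
    rw [HasCompactSupport.toSchwartzMap_toFun]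
    rw [not_and_or, not_lt, not_lt] at hcon
    have hpy : p y = 0 := by
      rcases hcon with h | h
      · exact hp y ((le_abs_self y).trans h)
      · rcases le_abs.1 h with h | h
        · exact p.zero_of_le_dist (by
            rw [Real.dist_eq, le_abs]; left; change (2 : ℝ) ≤ _; linarith)
        · exact hp y (by linarith)
    have hqy : q y = 0 := by
      rcases hcon with h | h
      · exact hq y (by linarith [neg_abs_le y])
      · rcases le_abs.1 h with h | h
        · exact hq y (by linarith)
        · exact q.zero_of_le_dist (by
            rw [Real.dist_eq, le_abs]; right; change (2 : ℝ) ≤ _; linarith)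
    rw [hpy, hqy]; simp

/-- The integers of `(X, 2X]`. -/
noncomputable def dyadicRange (X : ℝ) : Finset ℕ :=
  (Finset.range (⌊2 * X⌋₊ + 1)).filter fun n => X < (n : ℝ)

lemma mem_dyadicRange {X : ℝ} (hX : 0 ≤ X) {n : ℕ} :
    n ∈ dyadicRange X ↔ X < (n : ℝ) ∧ (n : ℝ) ≤ 2 * X := by
  rw [dyadicRange, Finset.mem_filter, Finset.mem_range, Nat.lt_succ_iff,
    Nat.le_floor_iff (by positivity), and_comm]

section FiniteSums

variable {X : ℝ} {f : ℕ → ℂ}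

lemma expSumR_eq_sum (hX : 0 ≤ X) (hf : ∀ n : ℕ, f n ≠ 0 → X < (n : ℝ) ∧ (n : ℝ) ≤ 2 * X)
    (θ : ℝ) : expSumR f θ = ∑ n ∈ dyadicRange X, f n * eR (θ * n) := by
  refine finsum_eq_sum_of_support_subset _ fun n hn => ?_
  exact (mem_dyadicRange hX).2 (hf n (left_ne_zero_of_mul hn))

lemma dirPoly_eq_sum (hX : 0 ≤ X) (hf : ∀ n : ℕ, f n ≠ 0 → X < (n : ℝ) ∧ (n : ℝ) ≤ 2 * X)
    (s : ℂ) : dirPoly f s = ∑ n ∈ dyadicRange X, f n / (n : ℂ) ^ s := by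
  refine finsum_eq_sum_of_support_subset _ fun n hn => ?_
  exact (mem_dyadicRange hX).2 (hf n fun h => hn (by simp [h]))

lemma continuous_expSumR (hX : 0 ≤ X)
    (hf : ∀ n : ℕ, f n ≠ 0 → X < (n : ℝ) ∧ (n : ℝ) ≤ 2 * X) : Continuous (expSumR f) := by
  rw [funext (expSumR_eq_sum hX hf)]
  exact continuous_finsetSum _ fun n _ =>
    continuous_const.mul (continuous_eR.comp (continuous_id.mul continuous_const))

/-- A term of the Dirichlet polynomial on the critical line as an additive character of `log n`. -/
lemma div_cpow_half_eq {n : ℕ} (hn : 0 < n) (a : ℂ) (τ : ℝ) :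
    a / (n : ℂ) ^ (1 / 2 + Complex.I * ((-(2 * π) * τ : ℝ) : ℂ)) =
      a * ((√n)⁻¹ : ℂ) * eR (log n * τ) := by
  have hn' : (n : ℂ) ≠ 0 := by exact_mod_cast hn.ne'
  have hs : (n : ℂ) ^ (1 / 2 : ℂ) = (√(n : ℝ) : ℂ) := by
    rw [Real.sqrt_eq_rpow, Complex.ofReal_cpow (by positivity)]
    push_cast; rfl
  rw [Complex.cpow_add _ _ hn', hs, div_eq_mul_inv, mul_inv, ← mul_assoc]
  congr 1
  rw [Complex.cpow_def_of_ne_zero hn', ← Complex.exp_neg, eR, ← Complex.natCast_log]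
  congr 1
  push_cast
  ring

lemma continuous_dirPoly (hX : 0 ≤ X)
    (hf : ∀ n : ℕ, f n ≠ 0 → X < (n : ℝ) ∧ (n : ℝ) ≤ 2 * X) :
    Continuous fun t : ℝ => dirPoly f (1 / 2 + Complex.I * (t : ℂ)) := by
  simp_rw [dirPoly_eq_sum hX hf]
  refine continuous_finsetSum _ fun n hn => ?_
  have hn' : (n : ℂ) ≠ 0 := by
    have := hX.trans_lt ((mem_dyadicRange hX).1 hn).1
    exact_mod_cast this.ne'
  refine continuous_const.div ?_ fun t => ?_
  · exact Continuous.const_cpow (by fun_prop) (Or.inl hn')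
  · rw [Complex.cpow_def_of_ne_zero hn']; exact Complex.exp_ne_zero _

end FiniteSums

lemma isCompact_setOf_le_abs_le (a b : ℝ) : IsCompact {t : ℝ | a ≤ |t| ∧ |t| ≤ b} := by
  refine (isCompact_Icc (a := -b) (b := b)).of_isClosed_subset ?_ fun t ht => abs_le.1 ht.2
  exact (isClosed_le continuous_const continuous_abs).inter
    (isClosed_le continuous_abs continuous_const)

lemma ofReal_setIntegral_norm_sq {g : ℝ → ℂ} (hg : Continuous g) {S : Set ℝ} (hS : IsCompact S) :
    ENNReal.ofReal (∫ t in S, ‖g t‖ ^ 2) = ∫⁻ t in S, ‖g t‖ₑ ^ 2 := by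
  have hint : IntegrableOn (fun t => ‖g t‖ ^ 2) S :=
    (hg.norm.pow 2).continuousOn.integrableOn_compact hS
  rw [ofReal_integral_eq_lintegral_ofReal hint (ae_of_all _ fun _ => by positivity)]
  congr 1 with t
  rw [ENNReal.ofReal_pow (norm_nonneg _), ofReal_norm]

lemma ofReal_integral_window_sq {X H : ℝ} {f : ℕ → ℂ} (hX : 0 ≤ X)
    (hf : ∀ n : ℕ, f n ≠ 0 → X < (n : ℝ) ∧ (n : ℝ) ≤ 2 * X) :
    ENNReal.ofReal (∫ x : ℝ, (∑ n ∈ Finset.Icc ⌈x⌉₊ ⌊x + H⌋₊, ‖f n‖) ^ 2) =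
      ∫⁻ x, windowSum (dyadicRange X) (fun n => ‖f n‖ₑ) H x ^ 2 := by
  have e : ∀ x : ℝ, ∑ n ∈ Finset.Icc ⌈x⌉₊ ⌊x + H⌋₊, ‖f n‖ =
      ∑ n ∈ dyadicRange X, (Set.Icc ((n : ℝ) - H) n).indicator (fun _ => ‖f n‖) x := by
    intro x
    have h1 : ∑ n ∈ Finset.Icc ⌈x⌉₊ ⌊x + H⌋₊, ‖f n‖ = ∑ᶠ n : ℕ,
        (Set.Icc ((n : ℝ) - H) n).indicator (fun _ => ‖f n‖) x := by
      rw [finsum_eq_sum_of_support_subset (s := Finset.Icc ⌈x⌉₊ ⌊x + H⌋₊)]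
      · refine Finset.sum_congr rfl fun n hn => ?_
        rw [Finset.mem_Icc] at hn
        by_cases h0 : f n = 0
        · simp [h0]
        have hn0 : 0 < (n : ℝ) := hX.trans_lt (hf n h0).1
        have h2 := (Nat.le_floor_iff' (by exact_mod_cast hn0.ne')).1 hn.2
        rw [Set.indicator_of_mem]
        exact ⟨by linarith, Nat.ceil_le.1 hn.1⟩
      · intro n hn
        have hm := Set.mem_of_indicator_ne_zero hn
        have h0 : f n ≠ 0 := fun h => hn (by simp [h])
        have hn0 : 0 < (n : ℝ) := hX.trans_lt (hf n h0).1
        rw [Finset.coe_Icc]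
        exact ⟨Nat.ceil_le.2 hm.2,
          (Nat.le_floor_iff' (by exact_mod_cast hn0.ne')).2 (by linarith [hm.1])⟩
    rw [h1]
    refine finsum_eq_sum_of_support_subset _ fun n hn => ?_
    exact (mem_dyadicRange hX).2 (hf n fun h => hn (by simp [h]))
  simp_rw [e]
  have hmem : MemLp (fun x : ℝ => ∑ n ∈ dyadicRange X,
      (Set.Icc ((n : ℝ) - H) n).indicator (fun _ => ‖f n‖) x) 2 :=
    memLp_finsetSum _ fun n _ => memLp_indicator_const 2 measurableSet_Icc _
      (Or.inr measure_Icc_lt_top.ne)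
  have hnn : ∀ x : ℝ, ∀ n : ℕ, 0 ≤ (Set.Icc ((n : ℝ) - H) n).indicator (fun _ => ‖f n‖) x :=
    fun x n => Set.indicator_nonneg (fun _ _ => norm_nonneg _) x
  rw [ofReal_integral_eq_lintegral_ofReal hmem.integrable_sq (ae_of_all _ fun _ => by positivity)]
  congr 1 with x
  rw [ENNReal.ofReal_pow (Finset.sum_nonneg fun n _ => hnn x n),
    ENNReal.ofReal_sum_of_nonneg fun n _ => hnn x n, windowSum]
  congr 2 with n
  by_cases h : x ∈ Set.Icc ((n : ℝ) - H) n
  · simp only [Set.indicator_of_mem h, ofReal_norm]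
  · simp only [Set.indicator_of_notMem h, ENNReal.ofReal_zero]

lemma lintegral_comp_log (G : ℝ → ℂ) :
    ∫⁻ z in Set.Ioi (0 : ℝ), ‖((√z)⁻¹ : ℂ) * G (log z)‖ₑ ^ 2 = ∫⁻ u, ‖G u‖ₑ ^ 2 := by
  have h := lintegral_image_eq_lintegral_abs_deriv_mul MeasurableSet.univ
    (fun u _ => (Real.hasDerivAt_exp u).hasDerivWithinAt) Real.exp_injective.injOn
    (fun z => ‖((√z)⁻¹ : ℂ) * G (log z)‖ₑ ^ 2)
  rw [Set.image_univ, Real.range_exp, setLIntegral_univ] at h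
  rw [h]
  congr 1 with u
  rw [Real.log_exp, abs_of_pos (Real.exp_pos u), enorm_mul, mul_pow, ← mul_assoc]
  have : ENNReal.ofReal (exp u) * ‖((√(exp u))⁻¹ : ℂ)‖ₑ ^ 2 = 1 := by
    rw [← ofReal_norm, norm_inv, Complex.norm_real, Real.norm_of_nonneg (Real.sqrt_nonneg _),
      ← ENNReal.ofReal_pow (by positivity), ← ENNReal.ofReal_mul (by positivity), inv_pow,
      Real.sq_sqrt (Real.exp_pos u).le, mul_inv_cancel₀ (Real.exp_pos u).ne', ENNReal.ofReal_one]
  rw [this, one_mul]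

lemma lintegral_comp_neg_two_pi_mul (g : ℝ → ENNReal) :
    ∫⁻ τ : ℝ, g (-(2 * π) * τ) ≤ ∫⁻ t, g t := by
  have hne : -(2 * π) ≠ 0 := by have := Real.pi_pos; linarith
  have h := (Homeomorph.mulLeft₀ (-(2 * π)) hne).measurableEmbedding.lintegral_map
    (μ := volume) g
  rw [show ⇑(Homeomorph.mulLeft₀ (-(2 * π)) hne) = fun x => -(2 * π) * x from rfl] at h
  rw [← h, Real.map_volume_mul_left hne, lintegral_smul_measure, smul_eq_mul]
  refine mul_le_of_le_one_left' ?_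
  rw [ENNReal.ofReal_le_one, abs_inv, abs_neg, abs_of_pos (by positivity)]
  exact inv_le_one_of_one_le₀ (by linarith [Real.pi_gt_three])

open FourierTransform in
/-- The part of an exponential sum reproduced by a Mellin-side frequency cutoff is controlled by
the mean square of the Dirichlet polynomial. -/
lemma lintegral_dirPoly_cutoff_le {X H η : ℝ} (hH : 0 < H) (hX : 0 < X) (hη : 0 < η)
    (hη' : η ≤ 1 / 32) {f : ℕ → ℂ}
    (hf : ∀ n : ℕ, f n ≠ 0 → X < (n : ℝ) ∧ (n : ℝ) ≤ 2 * X) {χ : SchwartzMap ℝ ℂ}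
    (hχ2 : ∀ y, ‖χ y‖ ≤ 2) (hχs : ∀ y, χ y ≠ 0 → 1 / 2 < |y| ∧ |y| < 9 / 2) :
    ∫⁻ τ : ℝ, ‖∑ n ∈ dyadicRange X,
        f n * ((√n)⁻¹ : ℂ) * (eR (log n * τ) * χ (τ / (X / H)))‖ₑ ^ 2 ≤
      4 * ∫⁻ t in {t : ℝ | η * (1 / H) * X ≤ |t| ∧ |t| ≤ (1 / H) * X / η},
        ‖dirPoly f (1 / 2 + Complex.I * (t : ℂ))‖ₑ ^ 2 := by
  set I := {t : ℝ | η * (1 / H) * X ≤ |t| ∧ |t| ≤ (1 / H) * X / η} with hI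
  have hIm : MeasurableSet I := (isCompact_setOf_le_abs_le _ _).measurableSet
  have hl : 0 < X / H := by positivity
  set g : ℝ → ENNReal := I.indicator fun t => ‖dirPoly f (1 / 2 + Complex.I * (t : ℂ))‖ₑ ^ 2
    with hg
  rw [← lintegral_indicator hIm]
  refine le_trans ?_ (mul_le_mul_right (lintegral_comp_neg_two_pi_mul g) 4)
  rw [← lintegral_const_mul' _ _ (by simp)]
  refine lintegral_mono fun τ => ?_
  have hsum : ∑ n ∈ dyadicRange X, f n * ((√n)⁻¹ : ℂ) * (eR (log n * τ) * χ (τ / (X / H))) =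
      χ (τ / (X / H)) * dirPoly f (1 / 2 + Complex.I * ((-(2 * π) * τ : ℝ) : ℂ)) := by
    rw [dirPoly_eq_sum hX.le hf, Finset.mul_sum]
    refine Finset.sum_congr rfl fun n hn => ?_
    have hn0 := hX.trans ((mem_dyadicRange hX.le).1 hn).1
    rw [div_cpow_half_eq (by exact_mod_cast hn0)]
    ring
  rw [hsum]
  by_cases h0 : χ (τ / (X / H)) = 0
  · simp [h0]
  obtain ⟨h1, h2⟩ := hχs _ h0
  rw [abs_div, abs_of_pos hl, lt_div_iff₀ hl] at h1
  rw [abs_div, abs_of_pos hl, div_lt_iff₀ hl] at h2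
  have hmem : -(2 * π) * τ ∈ I := by
    have hpi := Real.pi_gt_three
    have hpi' := Real.pi_lt_d2
    have habs : |-(2 * π) * τ| = 2 * π * |τ| := by
      rw [abs_mul, abs_neg, abs_of_pos (by positivity)]
    rw [hI, Set.mem_ofPred_eq, habs, show η * (1 / H) * X = η * (X / H) by ring,
      show 1 / H * X / η = (X / H) / η by ring]
    constructor
    · nlinarith
    · rw [le_div_iff₀ hη]
      calc 2 * π * |τ| * η ≤ 2 * π * |τ| * (1 / 32) := by gcongr
        _ ≤ 2 * 3.15 * |τ| * (1 / 32) := by gcongr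
        _ ≤ X / H := by nlinarith
  rw [hg, Set.indicator_of_mem hmem, enorm_mul, mul_pow]
  gcongr
  calc ‖χ (τ / (X / H))‖ₑ ^ 2 ≤ 2 ^ 2 := by
        gcongr
        rw [← ofReal_norm, ← ENNReal.ofReal_ofNat]
        exact ENNReal.ofReal_le_ofReal (hχ2 _)
    _ = 4 := by norm_num

/-- Pointwise comparison of the additive and multiplicative kernels attached to `n ∈ (X, 2X]`. -/
lemma norm_kernel_sub_le {w : ℝ → ℂ} {K : ℝ} (hK : 0 < K)
    (hw : ∀ l : ℝ, 1 ≤ l → ∀ r : ℝ,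
      (1 / 4 ≤ r → r ≤ 4 → ‖((√r)⁻¹ : ℂ) * w (l * log r) - w (l * (r - 1))‖
        ≤ K / l * (1 / (1 + (l * (r - 1)) ^ 2))) ∧
      (1 / 2 ≤ |r - 1| → ‖w (l * (r - 1))‖ ≤ K / l * (1 / (1 + (l * (r - 1)) ^ 2))))
    {X H : ℝ} (hH : 0 < H) (hHX : H ≤ X) {n : ℝ} (hn : X < n) (hn2 : n ≤ 2 * X) (z : ℝ) :
    ‖((X / H / n : ℝ) : ℂ) * w (X / H / n * (z - n)) -
      (Set.Icc (X / 2) (4 * X)).indicator (fun z : ℝ => ((√n)⁻¹ : ℂ) *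
        (((√z)⁻¹ : ℂ) * (((X / H : ℝ) : ℂ) * w (X / H * (log z - log n))))) z‖ ≤
      4 * K / X * (1 / (1 + ((z - n) / H) ^ 2)) := by
  have hX : 0 < X := hH.trans_le hHX
  have hn0 : 0 < n := hX.trans hn
  set l := X / H with hl
  have hl1 : 1 ≤ l := (one_le_div hH).2 hHX
  have hl0 : 0 < l := by linarith
  set r := z / n with hr
  have hlr : l / n * (z - n) = l * (r - 1) := by rw [hr]; field_simp
  have bound : l / n * (K / l * (1 / (1 + (l * (r - 1)) ^ 2))) ≤
      4 * K / X * (1 / (1 + ((z - n) / H) ^ 2)) := by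
    set q := (z - n) / H with hq
    have hlq : l * (r - 1) = X / n * q := by rw [hr, hq, hl]; field_simp
    have hXn : 1 / 2 ≤ X / n := by rw [div_le_div_iff₀ (by norm_num) hn0]; linarith
    have h4 : q ^ 2 ≤ 4 * (X / n * q) ^ 2 := by
      have : (1 / 2) ^ 2 ≤ (X / n) ^ 2 := by gcongr
      rw [mul_pow]
      nlinarith [sq_nonneg q]
    rw [hlq, show l / n * (K / l * (1 / (1 + (X / n * q) ^ 2))) =
      K / n * (1 / (1 + (X / n * q) ^ 2)) by field_simp,
      show 4 * K / X * (1 / (1 + q ^ 2)) = K / X * (4 / (1 + q ^ 2)) by ring]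
    gcongr ?_ * ?_
    · gcongr
    · rw [div_le_div_iff₀ (by positivity) (by positivity)]
      linarith
  refine le_trans ?_ bound
  rw [hlr]
  by_cases hz : z ∈ Set.Icc (X / 2) (4 * X)
  · have hz0 : 0 < z := by linarith [hz.1]
    have r1 : 1 / 4 ≤ r := by
      rw [hr, div_le_div_iff₀ (by norm_num) hn0]; linarith [hz.1]
    have r4 : r ≤ 4 := by rw [hr, div_le_iff₀ hn0]; linarith [hz.2]
    have hs : (√n)⁻¹ * (√z)⁻¹ = n⁻¹ * (√r)⁻¹ := by
      have hsn : √n ≠ 0 := (Real.sqrt_pos.2 hn0).ne'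
      have hsq : √n * √n = n := Real.mul_self_sqrt hn0.le
      rw [hr, Real.sqrt_div hz0.le, ← hsq]
      field_simp
      rw [Real.sqrt_sq (Real.sqrt_nonneg n)]
    have e : ((l / n : ℝ) : ℂ) * w (l * (r - 1)) - ((√n)⁻¹ : ℂ) *
        (((√z)⁻¹ : ℂ) * ((l : ℂ) * w (l * (log z - log n)))) =
        -(((l / n : ℝ) : ℂ) * (((√r)⁻¹ : ℂ) * w (l * log r) - w (l * (r - 1)))) := by
      have hs' : ((√n)⁻¹ : ℂ) * ((√z)⁻¹ : ℂ) = (n : ℂ)⁻¹ * ((√r)⁻¹ : ℂ) := by exact_mod_cast hs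
      rw [← Real.log_div hz0.ne' hn0.ne', ← hr]
      push_cast
      linear_combination (-(l : ℂ) * w (l * log r)) * hs'
    rw [Set.indicator_of_mem hz, e, norm_neg, norm_mul, Complex.norm_real,
      Real.norm_of_nonneg (by positivity)]
    gcongr
    exact (hw l hl1 r).1 r1 r4
  · rw [Set.indicator_of_notMem hz, sub_zero, norm_mul, Complex.norm_real,
      Real.norm_of_nonneg (by positivity)]
    gcongr
    refine (hw l hl1 r).2 ?_
    rw [le_abs]
    rw [Set.mem_Icc, not_and_or, not_le, not_le] at hz
    rcases hz with h | h
    · right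
      have : r ≤ 1 / 2 := by rw [hr, div_le_iff₀ hn0]; linarith
      linarith
    · left
      have : 2 ≤ r := by rw [hr, le_div_iff₀ hn0]; linarith
      linarith

open FourierTransform in
/-- Mean-square bound for an exponential sum at the scale `1 / H`, with a constant depending only
on a fixed frequency cutoff. -/
lemma exists_lintegral_expSumR_sq_le :
    ∃ K : ℝ, 0 < K ∧ ∀ H X : ℝ, 1 ≤ H → H ≤ X →
    ∀ f : ℕ → ℂ, (∀ n : ℕ, f n ≠ 0 → X < (n : ℝ) ∧ (n : ℝ) ≤ 2 * X) →
    ∀ η : ℝ, 0 < η → η ≤ 1 / 32 →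
      ∫⁻ θ in {θ : ℝ | 1 / H ≤ |θ| ∧ |θ| ≤ 2 * (1 / H)}, ‖expSumR f θ‖ₑ ^ 2 ≤
        12 * (∫⁻ t in {t : ℝ | η * (1 / H) * X ≤ |t| ∧ |t| ≤ (1 / H) * X / η},
          ‖dirPoly f (1 / 2 + Complex.I * (t : ℂ))‖ₑ ^ 2) +
        ENNReal.ofReal (K / X ^ 2) *
          ∫⁻ x, windowSum (dyadicRange X) (fun n => ‖f n‖ₑ) H x ^ 2 := by
  obtain ⟨χ, hχc, hχ1, hχ2, hχs⟩ := exists_schwartz_cutoff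
  obtain ⟨K₁, hK₁, hker⟩ := (𝓕 χ).exists_log_kernel_bound
  obtain ⟨K₂, hK₂, hwin⟩ := exists_lintegral_kernel_sq_le
  refine ⟨3 * (4 * K₁) ^ 2 * K₂, by positivity, fun H X hH hHX f hf η hη hη' => ?_⟩
  have hH0 : 0 < H := by linarith
  have hX : 0 < X := by linarith
  have hnX : ∀ n ∈ dyadicRange X, X < (n : ℝ) ∧ (n : ℝ) ≤ 2 * X :=
    fun n hn => (mem_dyadicRange hX.le).1 hn
  obtain ⟨A, hA, hAF⟩ := exists_schwartz_sum χ hχc (dyadicRange X) f (fun n => n)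
    (fun n => X / H / n) fun n hn => div_pos (by positivity) (hX.trans (hnX n hn).1)
  obtain ⟨B, hB, hBF⟩ := exists_schwartz_sum χ hχc (dyadicRange X) (fun n => f n * ((√n)⁻¹ : ℂ))
    (fun n => log n) (fun _ => X / H) fun n hn => by positivity
  set J := Set.Icc (X / 2) (4 * X) with hJ
  set P : ℝ → ℂ := fun z => ((√z)⁻¹ : ℂ) * 𝓕 B (log z) with hP
  set E : ℝ → ENNReal := fun z => ∑ n ∈ dyadicRange X,
    ‖f n‖ₑ * ENNReal.ofReal (1 / (1 + ((z - n) / H) ^ 2)) with hE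
  have hAS : ∀ θ ∈ {θ : ℝ | 1 / H ≤ |θ| ∧ |θ| ≤ 2 * (1 / H)}, expSumR f θ = A θ := by
    intro θ hθ
    rw [expSumR_eq_sum hX.le hf, hA]
    refine Finset.sum_congr rfl fun n hn => ?_
    obtain ⟨n1, n2⟩ := hnX n hn
    have hn0 : (0 : ℝ) < n := hX.trans n1
    have habs : |θ / (X / H / n)| = (|θ| * H) * (n / X) := by
      rw [abs_div, abs_of_pos (show 0 < X / H / n by positivity)]; field_simp
    have a1 : 1 ≤ |θ| * H := (div_le_iff₀ hH0).1 hθ.1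
    have a2 : |θ| * H ≤ 2 := by
      have := mul_le_mul_of_nonneg_right hθ.2 hH0.le
      rwa [mul_assoc, one_div, inv_mul_cancel₀ hH0.ne', mul_one] at this
    have b1 : 1 ≤ n / X := (one_le_div hX).2 n1.le
    have b2 : n / X ≤ 2 := (div_le_iff₀ hX).2 n2
    rw [hχ1 _ (by rw [habs]; nlinarith) (by rw [habs]; nlinarith), mul_one, mul_comm θ]
  have hdiff : ∀ z, ‖𝓕 A z - J.indicator P z‖ₑ ≤ ENNReal.ofReal (4 * K₁ / X) * E z := by
    intro z
    have e : 𝓕 A z - J.indicator P z = ∑ n ∈ dyadicRange X, f n *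
        (((X / H / n : ℝ) : ℂ) * 𝓕 χ (X / H / n * (z - n)) -
        J.indicator (fun z : ℝ => ((√n)⁻¹ : ℂ) * (((√z)⁻¹ : ℂ) *
          (((X / H : ℝ) : ℂ) * 𝓕 χ (X / H * (log z - log n))))) z) := by
      rw [Finset.sum_congr rfl fun n _ => mul_sub (f n) _ _, Finset.sum_sub_distrib, hAF]
      congr 1
      by_cases hz : z ∈ J
      · simp only [Set.indicator_of_mem hz]
        simp only [hP, hBF, Finset.mul_sum]
        exact Finset.sum_congr rfl fun n _ => by ring
      · simp [Set.indicator_of_notMem hz]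
    rw [e, hE, Finset.mul_sum]
    refine (enorm_sum_le _ _).trans (Finset.sum_le_sum fun n hn => ?_)
    rw [enorm_mul, mul_left_comm]
    gcongr
    rw [← ofReal_norm, ← ENNReal.ofReal_mul (by positivity)]
    exact ENNReal.ofReal_le_ofReal
      (norm_kernel_sub_le hK₁ hker hH0 hHX (hnX n hn).1 (hnX n hn).2 z)
  have hPJ : ∫⁻ z, ‖J.indicator P z‖ₑ ^ 2 ≤
      4 * ∫⁻ t in {t : ℝ | η * (1 / H) * X ≤ |t| ∧ |t| ≤ (1 / H) * X / η},
        ‖dirPoly f (1 / 2 + Complex.I * (t : ℂ))‖ₑ ^ 2 := by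
    calc ∫⁻ z, ‖J.indicator P z‖ₑ ^ 2
        ≤ ∫⁻ z, (Set.Ioi (0 : ℝ)).indicator (fun z => ‖P z‖ₑ ^ 2) z := by
          refine lintegral_mono fun z => ?_
          by_cases hz : z ∈ J
          · have hz0 : z ∈ Set.Ioi (0 : ℝ) := (half_pos hX).trans_le hz.1
            rw [Set.indicator_of_mem hz, Set.indicator_of_mem hz0]
          · simp [Set.indicator_of_notMem hz]
      _ = ∫⁻ τ, ‖B τ‖ₑ ^ 2 := by
          rw [lintegral_indicator measurableSet_Ioi, ← lintegral_enorm_sq_fourier]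
          exact lintegral_comp_log (𝓕 B : SchwartzMap ℝ ℂ)
      _ ≤ _ := by
          simp_rw [hB]
          exact lintegral_dirPoly_cutoff_le hH0 hX hη hη' hf hχ2 hχs
  have hEm : Measurable E := by
    refine Finset.measurable_fun_sum _ fun n _ => ?_
    fun_prop
  calc ∫⁻ θ in {θ : ℝ | 1 / H ≤ |θ| ∧ |θ| ≤ 2 * (1 / H)}, ‖expSumR f θ‖ₑ ^ 2
      = ∫⁻ θ in {θ : ℝ | 1 / H ≤ |θ| ∧ |θ| ≤ 2 * (1 / H)}, ‖A θ‖ₑ ^ 2 :=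
        setLIntegral_congr_fun (isCompact_setOf_le_abs_le _ _).measurableSet
          fun θ hθ => by simp only [hAS θ hθ]
    _ ≤ ∫⁻ z, ‖𝓕 A z‖ₑ ^ 2 := by
        rw [lintegral_enorm_sq_fourier]
        exact setLIntegral_le_lintegral _ _
    _ ≤ ∫⁻ z, (3 * ‖J.indicator P z‖ₑ ^ 2 +
          3 * (ENNReal.ofReal (4 * K₁ / X) * E z) ^ 2) := by
        refine lintegral_mono fun z => ?_
        refine le_trans ?_ (ENNReal.add_sq_le _ _)
        gcongr
        calc ‖𝓕 A z‖ₑ = ‖J.indicator P z + (𝓕 A z - J.indicator P z)‖ₑ := by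
              rw [add_sub_cancel]
          _ ≤ _ := (enorm_add_le _ _).trans (by gcongr; exact hdiff z)
    _ = 3 * (∫⁻ z, ‖J.indicator P z‖ₑ ^ 2) +
          3 * ENNReal.ofReal (4 * K₁ / X) ^ 2 * ∫⁻ z, E z ^ 2 := by
        rw [lintegral_add_right _ (((hEm.const_mul _).pow_const 2).const_mul 3),
          lintegral_const_mul' _ _ (by simp)]
        congr 1
        simp_rw [mul_pow, ← mul_assoc]
        rw [lintegral_const_mul _ (hEm.pow_const 2)]
    _ ≤ 3 * (4 * ∫⁻ t in {t : ℝ | η * (1 / H) * X ≤ |t| ∧ |t| ≤ (1 / H) * X / η},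
          ‖dirPoly f (1 / 2 + Complex.I * (t : ℂ))‖ₑ ^ 2) +
          3 * ENNReal.ofReal (4 * K₁ / X) ^ 2 * (ENNReal.ofReal K₂ *
            ∫⁻ x, windowSum (dyadicRange X) (fun n => ‖f n‖ₑ) H x ^ 2) := by
        gcongr
        exact hwin _ _ _ hH0
    _ = _ := by
        have hc : ENNReal.ofReal (3 * (4 * K₁) ^ 2 * K₂ / X ^ 2) =
            3 * ENNReal.ofReal (4 * K₁ / X) ^ 2 * ENNReal.ofReal K₂ := by
          rw [← ENNReal.ofReal_pow (by positivity), ← ENNReal.ofReal_ofNat,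
            ← ENNReal.ofReal_mul (by norm_num), ← ENNReal.ofReal_mul (by positivity)]
          congr 1
          ring
        rw [hc, ← mul_assoc, ← mul_assoc]
        norm_num

/-- **Stationary phase bound for short `L²` averages of exponential sums
(endpoint `β = 1/H`).** -/
theorem stationary_phase_endpoint :
    ∃ c C : ℝ, 0 < c ∧ c < 1 ∧ 0 < C ∧
    ∀ H X : ℝ, 1 ≤ H → H ≤ X →
    ∀ f : ℕ → ℂ, (∀ n : ℕ, f n ≠ 0 → X < (n : ℝ) ∧ (n : ℝ) ≤ 2 * X) →
    ∀ η : ℝ, 0 < η → η ≤ c → 1 / H ≤ c * η →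
      (∫ θ in {θ : ℝ | 1 / H ≤ |θ| ∧ |θ| ≤ 2 * (1 / H)}, ‖expSumR f θ‖ ^ 2)
        ≤ C * ((∫ t in {t : ℝ | η * (1 / H) * X ≤ |t| ∧ |t| ≤ (1 / H) * X / η},
                ‖dirPoly f (1 / 2 + Complex.I * (t : ℂ))‖ ^ 2)
            + ((η + 1 / ((1 / H) * X)) ^ 2 / H ^ 2) *
              (∫ x : ℝ, (∑ n ∈ Finset.Icc ⌈x⌉₊ ⌊x + H⌋₊, ‖f n‖) ^ 2)) := by
  obtain ⟨K, hK, hmain⟩ := exists_lintegral_expSumR_sq_le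
  refine ⟨1 / 32, 12 + K, by norm_num, by norm_num, by positivity,
    fun H X hH hHX f hf η hη hη' _ => ?_⟩
  have hH0 : 0 < H := by linarith
  have hX : 0 < X := by linarith
  set D := ∫ t in {t : ℝ | η * (1 / H) * X ≤ |t| ∧ |t| ≤ (1 / H) * X / η},
    ‖dirPoly f (1 / 2 + Complex.I * (t : ℂ))‖ ^ 2 with hD
  set W := ∫ x : ℝ, (∑ n ∈ Finset.Icc ⌈x⌉₊ ⌊x + H⌋₊, ‖f n‖) ^ 2 with hW
  have hD0 : 0 ≤ D := integral_nonneg fun _ => by positivity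
  have hW0 : 0 ≤ W := integral_nonneg fun _ => by positivity
  have h := hmain H X hH hHX f hf η hη hη'
  rw [← ofReal_setIntegral_norm_sq (continuous_expSumR hX.le hf)
      (isCompact_setOf_le_abs_le _ _),
    ← ofReal_setIntegral_norm_sq (continuous_dirPoly hX.le hf) (isCompact_setOf_le_abs_le _ _),
    ← ofReal_integral_window_sq hX.le hf, ← hD, ← hW, ← ENNReal.ofReal_ofNat,
    ← ENNReal.ofReal_mul (by norm_num), ← ENNReal.ofReal_mul (by positivity),
    ← ENNReal.ofReal_add (by positivity) (by positivity),
    ENNReal.ofReal_le_ofReal_iff (by positivity)] at h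
  refine h.trans ?_
  have hcoef : 1 / X ^ 2 ≤ (η + 1 / ((1 / H) * X)) ^ 2 / H ^ 2 := by
    rw [le_div_iff₀ (by positivity), show 1 / X ^ 2 * H ^ 2 = (1 / ((1 / H) * X)) ^ 2 by
      field_simp]
    gcongr
    linarith
  rw [mul_add]
  have h1 : (12 : ℝ) * D ≤ (12 + K) * D := by gcongr; linarith
  have h2 : K / X ^ 2 * W ≤ (12 + K) * ((η + 1 / ((1 / H) * X)) ^ 2 / H ^ 2 * W) := by
    rw [← mul_assoc, div_eq_mul_one_div]
    gcongr
    linarith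
  exact add_le_add h1 h2
end
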